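/- arXiv:2203.12179 — 2 statements merged into one kernel-verified Lean document; each statement's English description precedes it below -/
import Mathlib

section
/- Suppose (X_i, D_i, Y_i(0), Y_i(1)) satisfies conditional ignorability, the weight is of the form w_i = w(X_i, D_i) for a measurable function w, and all the expectations below exist and are finite. Then E[w_i Y_i(0) | D_i = 0] = E[Y_i(0) | D_i = 1] holds if and only if the weighting condition E[w_i f_0(X_i) | D_i = 0] = E[f_0(X_i) | D_i = 1] holds; in particular, E[w_i Y_i(0) | D_i = 0] = E[w_i f_0(X_i) | D_i = 0] and E[Y_i(0) | D_i = 1] = E[f_0(X_i) | D_i = 1]. -/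
open MeasureTheory ProbabilityTheory Filter
open scoped ENNReal NNReal Topology BigOperators

noncomputable section

/-- **The weighting condition (TFB paper, Section 3.1).**  If `(X, D, Y(0), Y(1))`
satisfies conditional ignorability and the weight is an honest function `w(X, D)` of the
covariates and the treatment, then (all the relevant expectations being assumed finite)
`E[w Y(0) | D = 0] = E[Y(0) | D = 1]` holds if and only if the weighting condition
`E[w f₀(X) | D = 0] = E[f₀(X) | D = 1]` holds; in particular
`E[w Y(0) | D = 0] = E[w f₀(X) | D = 0]` and `E[Y(0) | D = 1] = E[f₀(X) | D = 1]`. -/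
theorem tfb_weighting_condition
    {Ω : Type*} [MeasurableSpace Ω] [StandardBorelSpace Ω] [Nonempty Ω]
    (μ : Measure Ω) [IsProbabilityMeasure μ] (P : ℕ)
    (X : Ω → (Fin P → ℝ)) (D : Ω → Bool) (Y0 Y1 : Ω → ℝ)
    (f0 : (Fin P → ℝ) → ℝ) (w : (Fin P → ℝ) × Bool → ℝ)
    -- measurability
    (hX : Measurable X) (hD : Measurable D)
    (hY0 : Measurable Y0) (hY1 : Measurable Y1)
    (hf0 : Measurable f0) (hw : Measurable w)
    -- both treatment groups have positive probability
    (hD1pos : 0 < μ {ω | D ω = true}) (hD0pos : 0 < μ {ω | D ω = false})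
    -- conditional ignorability : (Y(0), Y(1)) ⟂ D | X
    (hCI : CondIndepFun (MeasurableSpace.comap X inferInstance) (hX.comap_le)
      (fun ω => (Y0 ω, Y1 ω)) D μ)
    -- f₀ is the conditional expectation function of Y(0) given X
    (hf0cond : (fun ω => f0 (X ω)) =ᵐ[μ] μ[Y0 | MeasurableSpace.comap X inferInstance])
    -- all the expectations below exist and are finite
    (hint1 : Integrable (fun ω => w (X ω, D ω) * Y0 ω) (ProbabilityTheory.cond μ {ω | D ω = false}))
    (hint2 : Integrable (fun ω => w (X ω, D ω) * f0 (X ω)) (ProbabilityTheory.cond μ {ω | D ω = false}))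
    (hint3 : Integrable Y0 (ProbabilityTheory.cond μ {ω | D ω = true}))
    (hint4 : Integrable (fun ω => f0 (X ω)) (ProbabilityTheory.cond μ {ω | D ω = true}))
    (hint5 : Integrable Y0 μ) (hint6 : Integrable (fun ω => f0 (X ω)) μ)
    (hint7 : Integrable (fun ω => w (X ω, D ω) * Y0 ω) μ)
    (hint8 : Integrable (fun ω => w (X ω, D ω) * f0 (X ω)) μ) :
    -- the two sides of the reduction
    (∫ ω, w (X ω, D ω) * Y0 ω ∂(ProbabilityTheory.cond μ {ω | D ω = false})
        = ∫ ω, w (X ω, D ω) * f0 (X ω) ∂(ProbabilityTheory.cond μ {ω | D ω = false}))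
    ∧ (∫ ω, Y0 ω ∂(ProbabilityTheory.cond μ {ω | D ω = true})
        = ∫ ω, f0 (X ω) ∂(ProbabilityTheory.cond μ {ω | D ω = true}))
    -- and hence the equivalence with the weighting condition
    ∧ ((∫ ω, w (X ω, D ω) * Y0 ω ∂(ProbabilityTheory.cond μ {ω | D ω = false})
          = ∫ ω, Y0 ω ∂(ProbabilityTheory.cond μ {ω | D ω = true}))
        ↔ (∫ ω, w (X ω, D ω) * f0 (X ω) ∂(ProbabilityTheory.cond μ {ω | D ω = false})
          = ∫ ω, f0 (X ω) ∂(ProbabilityTheory.cond μ {ω | D ω = true}))) := by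
  have hXD : Measurable (fun ω => (X ω, D ω)) := hX.prodMk hD
  have hci : CondIndepFun (MeasurableSpace.comap X inferInstance) hX.comap_le D Y0 μ :=
    (hCI.comp measurable_fst measurable_id).symm
  have hk := (condIndepFun_iff_condDistrib_prod_ae_eq_prodMkRight hY0 hD hX).1 hci
  have hk' := ae_of_ae_map hXD.aemeasurable hk
  have hE1 := condExp_ae_eq_integral_condDistrib' hXD hint5
  have hE2 := condExp_ae_eq_integral_condDistrib' hX hint5
  have hm : MeasurableSpace.comap (fun ω => (X ω, D ω)) inferInstance ≤ ‹MeasurableSpace Ω› :=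
    hXD.comap_le
  have hE : μ[Y0 | MeasurableSpace.comap (fun ω => (X ω, D ω)) inferInstance]
      =ᵐ[μ] fun ω => f0 (X ω) := by
    filter_upwards [hk', hE1, hE2, hf0cond] with ω h1 h2 h3 h4
    rw [h2, h4, h3, h1, Kernel.prodMkRight_apply]
  have key : ∀ (v : (Fin P → ℝ) × Bool → ℝ), Measurable v →
      Integrable (fun ω => v (X ω, D ω) * Y0 ω) μ → ∀ d : Bool,
      ∫ ω, v (X ω, D ω) * Y0 ω ∂(ProbabilityTheory.cond μ {ω | D ω = d})
        = ∫ ω, v (X ω, D ω) * f0 (X ω) ∂(ProbabilityTheory.cond μ {ω | D ω = d}) := by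
    intro v hv hvi d
    have hvm : StronglyMeasurable[MeasurableSpace.comap (fun ω => (X ω, D ω)) inferInstance]
        (fun ω => v (X ω, D ω)) :=
      (hv.comp (comap_measurable (fun ω => (X ω, D ω)))).stronglyMeasurable
    have hpull := condExp_mul_of_stronglyMeasurable_left (μ := μ) hvm hvi hint5
    have hs : MeasurableSet[MeasurableSpace.comap (fun ω => (X ω, D ω)) inferInstance]
        {ω | D ω = d} :=
      ⟨{p | p.2 = d}, measurable_snd (measurableSet_singleton d), rfl⟩
    have hset := setIntegral_condExp hm hvi hs
    unfold ProbabilityTheory.cond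
    rw [integral_smul_measure, integral_smul_measure, ← hset]
    congr 1
    refine integral_congr_ae (ae_restrict_of_ae ?_)
    filter_upwards [hpull, hE] with ω h1 h2
    refine h1.trans ?_
    rw [Pi.mul_apply, h2]
  have h1 := key w hw hint7 false
  have h2 := key (fun _ => 1) measurable_const (by simpa using hint5) true
  simp only [one_mul] at h2
  exact ⟨h1, h2, by rw [h1, h2]⟩


end
end

section
/- Suppose the probability limit of (1/n_c) Σ_{i:D_i=0} w_i² σ_i² is finite, and assume: (viii) (1/n_c) Σ_{i:D_i=0} w_i² ε_i² − (1/n_c) Σ_{i:D_i=0} w_i² σ_i² → 0 in probability, and (ix) (1/n_c) Σ_{i:D_i=0} w_i² [f_0(X_i) − f̂_0(X_i)]² = o_p(1). Then n · [ (1/n_c²) Σ_{i:D_i=0} w_i² (Y_i(0) − f̂_0(X_i))² − (1/n_c²) Σ_{i:D_i=0} w_i² σ_i² ] → 0 in probability, provided n_c/n converges in probability to a positive limit; that is, the weighted residual variance term of the plug-in variance estimator is consistent at rate o_p(n^{−1}) for (1/n_c²) Σ_{i:D_i=0} w_i² σ_i². -/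
open MeasureTheory ProbabilityTheory Filter
open scoped ENNReal NNReal Topology BigOperators

noncomputable section

lemma tfb_comb {Ω : Type*} [MeasurableSpace Ω] (μ : Measure Ω)
    (A B C F T : ℕ → Ω → ℝ) (a b g d t : ℝ)
    (hA : TendstoInMeasure μ A atTop (fun _ => a))
    (hB : TendstoInMeasure μ B atTop (fun _ => b))
    (hC : TendstoInMeasure μ C atTop (fun _ => g))
    (hF : TendstoInMeasure μ F atTop (fun _ => d))
    (h : ∀ e > 0, ∃ δ > 0, ∀ n ω, |A n ω - a| < δ → |B n ω - b| < δ → |C n ω - g| < δ →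
      |F n ω - d| < δ → |T n ω - t| < e) :
    TendstoInMeasure μ T atTop (fun _ => t) := by
  rw [tendstoInMeasure_iff_norm] at *
  intro e he
  obtain ⟨δ, hδ, h⟩ := h e he
  have h0 := (((hA δ hδ).add (hB δ hδ)).add (hC δ hδ)).add (hF δ hδ)
  simp only [add_zero] at h0
  refine tendsto_of_tendsto_of_tendsto_of_le_of_le tendsto_const_nhds h0
    (fun _ => zero_le) (fun n => ?_)
  refine le_trans (measure_mono ?_) ((measure_union_le _ _).trans (add_le_add_left
    ((measure_union_le _ _).trans (add_le_add_left (measure_union_le _ _) _)) _))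
  intro ω hω
  by_contra hn
  simp only [Set.mem_union, Set.mem_ofPred_eq, not_or, not_le, Real.norm_eq_abs] at hn hω
  exact absurd (h n ω hn.1.1.1 hn.1.1.2 hn.1.2 hn.2) (not_lt.2 hω)

lemma tfb_young {ι : Type*} (s : Finset ι) (w x y : ι → ℝ) (η r : ℝ) (hη : 0 < η) (hr : 0 ≤ r) :
    |r * ∑ i ∈ s, w i ^ 2 * (x i + y i) ^ 2 - r * ∑ i ∈ s, w i ^ 2 * x i ^ 2
      - r * ∑ i ∈ s, w i ^ 2 * y i ^ 2|
    ≤ η * (r * ∑ i ∈ s, w i ^ 2 * x i ^ 2) + η⁻¹ * (r * ∑ i ∈ s, w i ^ 2 * y i ^ 2) := by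
  have e1 : r * ∑ i ∈ s, w i ^ 2 * (x i + y i) ^ 2 - r * ∑ i ∈ s, w i ^ 2 * x i ^ 2
      - r * ∑ i ∈ s, w i ^ 2 * y i ^ 2 = ∑ i ∈ s, r * w i ^ 2 * (2 * x i * y i) := by
    simp only [Finset.mul_sum, ← Finset.sum_sub_distrib]
    exact Finset.sum_congr rfl fun i _ => by ring
  have e2 : η * (r * ∑ i ∈ s, w i ^ 2 * x i ^ 2) + η⁻¹ * (r * ∑ i ∈ s, w i ^ 2 * y i ^ 2)
      = ∑ i ∈ s, r * w i ^ 2 * (η * x i ^ 2 + η⁻¹ * y i ^ 2) := by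
    simp only [Finset.mul_sum, ← Finset.sum_add_distrib]
    exact Finset.sum_congr rfl fun i _ => by ring
  rw [e1, e2]
  refine (Finset.abs_sum_le_sum_abs _ _).trans (Finset.sum_le_sum fun i _ => ?_)
  have hp : 0 ≤ r * w i ^ 2 := by positivity
  rw [abs_mul, abs_of_nonneg hp]
  refine mul_le_mul_of_nonneg_left ?_ hp
  have q1 : η * x i ^ 2 + η⁻¹ * y i ^ 2 - 2 * x i * y i = η⁻¹ * (η * x i - y i) ^ 2 := by
    field_simp; ring
  have q2 : η * x i ^ 2 + η⁻¹ * y i ^ 2 + 2 * x i * y i = η⁻¹ * (η * x i + y i) ^ 2 := by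
    field_simp; ring
  have p1 : 0 ≤ η⁻¹ * (η * x i - y i) ^ 2 := by positivity
  have p2 : 0 ≤ η⁻¹ * (η * x i + y i) ^ 2 := by positivity
  rw [abs_le]; constructor <;> linarith

/-- **Consistency of the weighted residual variance term (TFB paper, eqs. (57)–(63)).**
Suppose the probability limit of `(1/n_c) ∑_{i:Dᵢ=0} wᵢ² σᵢ²` is finite, the weighted
squared errors concentrate on the weighted conditional variances (condition (viii)), the
weighted squared estimation error of `f̂₀` is `o_p(1)` (condition (ix)), and `n_c/n`
converges in probability to a positive limit.  Then
`n · [(1/n_c²) ∑_{i:Dᵢ=0} wᵢ² (Yᵢ(0) − f̂₀(Xᵢ))² − (1/n_c²) ∑_{i:Dᵢ=0} wᵢ² σᵢ²] → 0`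
in probability. -/
theorem tfb_weighted_residual_variance_consistency
    {Ω : Type*} [MeasurableSpace Ω]
    (μ : Measure Ω) [IsProbabilityMeasure μ] (P : ℕ)
    (X : ℕ → Ω → (Fin P → ℝ)) (D : ℕ → Ω → Bool) (Y0 Y1 : ℕ → Ω → ℝ)
    (w : ℕ → ℕ → Ω → ℝ) (f0 f1 : (Fin P → ℝ) → ℝ) (ε σsq : ℕ → Ω → ℝ)
    (fhat0 : ℕ → Ω → (Fin P → ℝ) → ℝ) (nc : ℕ → Ω → ℕ)
    -- measurability
    (hX : ∀ i, Measurable (X i)) (hD : ∀ i, Measurable (D i))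
    (hY0 : ∀ i, Measurable (Y0 i)) (hY1 : ∀ i, Measurable (Y1 i))
    (hf0 : Measurable f0) (hf1 : Measurable f1)
    (hw : ∀ n i, Measurable (w n i)) (hwpos : ∀ n i ω, 0 ≤ w n i ω)
    (hfhat0 : ∀ n, Measurable (fun p : Ω × (Fin P → ℝ) => fhat0 n p.1 p.2))
    -- the error εᵢ = Yᵢ(Dᵢ) − f_{Dᵢ}(Xᵢ), so Yᵢ(0) − f̂₀(Xᵢ) = εᵢ + (f₀(Xᵢ) − f̂₀(Xᵢ))
    -- for control units
    (hε : ∀ i ω, ε i ω = if D i ω then Y1 i ω - f1 (X i ω) else Y0 i ω - f0 (X i ω))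
    -- number of control units
    (hnc : ∀ n ω, nc n ω = ((Finset.range n).filter (fun i => D i ω = false)).card)
    -- the probability limit of (1/n_c) ∑_{i:Dᵢ=0} wᵢ² σᵢ² is finite
    (Vw : ℝ)
    (hplim : TendstoInMeasure μ (fun (n : ℕ) ω =>
        (nc n ω : ℝ)⁻¹ * ∑ i ∈ (Finset.range n).filter (fun i => D i ω = false),
          (w n i ω) ^ 2 * σsq i ω)
      atTop (fun _ => Vw))
    -- (viii) (1/n_c) ∑_{i:Dᵢ=0} wᵢ² εᵢ² − (1/n_c) ∑_{i:Dᵢ=0} wᵢ² σᵢ² → 0 in probability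
    (hviii : TendstoInMeasure μ (fun (n : ℕ) ω =>
        (nc n ω : ℝ)⁻¹ * ∑ i ∈ (Finset.range n).filter (fun i => D i ω = false),
          (w n i ω) ^ 2 * (ε i ω) ^ 2
      - (nc n ω : ℝ)⁻¹ * ∑ i ∈ (Finset.range n).filter (fun i => D i ω = false),
          (w n i ω) ^ 2 * σsq i ω)
      atTop (fun _ => (0 : ℝ)))
    -- (ix) (1/n_c) ∑_{i:Dᵢ=0} wᵢ² [f₀(Xᵢ) − f̂₀(Xᵢ)]² = o_p(1)
    (hix : TendstoInMeasure μ (fun (n : ℕ) ω =>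
        (nc n ω : ℝ)⁻¹ * ∑ i ∈ (Finset.range n).filter (fun i => D i ω = false),
          (w n i ω) ^ 2 * (f0 (X i ω) - fhat0 n ω (X i ω)) ^ 2)
      atTop (fun _ => (0 : ℝ)))
    -- n_c/n converges in probability to a positive limit
    (c : ℝ) (hc : 0 < c)
    (hncn : TendstoInMeasure μ (fun (n : ℕ) ω => (nc n ω : ℝ) / (n : ℝ))
      atTop (fun _ => c)) :
    -- conclusion
    TendstoInMeasure μ (fun (n : ℕ) ω => (n : ℝ) *
        (((nc n ω : ℝ) ^ 2)⁻¹ *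
            ∑ i ∈ (Finset.range n).filter (fun i => D i ω = false),
              (w n i ω) ^ 2 * (Y0 i ω - fhat0 n ω (X i ω)) ^ 2
         - ((nc n ω : ℝ) ^ 2)⁻¹ *
            ∑ i ∈ (Finset.range n).filter (fun i => D i ω = false),
              (w n i ω) ^ 2 * σsq i ω))
      atTop (fun _ => (0 : ℝ)) := by
  refine tfb_comb μ _ _ _ _ _ _ _ _ _ _ hplim hviii hix hncn ?_
  intro e he
  obtain ⟨K, hK⟩ : ∃ K, K = |Vw| + 2 := ⟨_, rfl⟩
  have hKpos : 0 < K := by rw [hK]; positivity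
  obtain ⟨η, hη⟩ : ∃ η, η = e * c / (8 * K) := ⟨_, rfl⟩
  have hηpos : 0 < η := by rw [hη]; positivity
  refine ⟨min (min 1 (c / 2)) (e * c / (8 * (2 + η⁻¹))), by positivity, ?_⟩
  intro n ω h1 h2 h3 h4
  obtain ⟨δ, hδ⟩ : ∃ δ, δ = min (min 1 (c / 2)) (e * c / (8 * (2 + η⁻¹))) := ⟨_, rfl⟩
  rw [← hδ] at h1 h2 h3 h4
  have d1 : δ ≤ 1 := by rw [hδ]; exact (min_le_left _ _).trans (min_le_left _ _)
  have d2 : δ ≤ c / 2 := by rw [hδ]; exact (min_le_left _ _).trans (min_le_right _ _)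
  have d3 : δ * (2 + η⁻¹) ≤ e * c / 8 := by
    have : δ ≤ e * c / (8 * (2 + η⁻¹)) := by rw [hδ]; exact min_le_right _ _
    have hp : 0 < 2 + η⁻¹ := by positivity
    rw [le_div_iff₀ (by positivity)] at this
    linarith
  have d4 : η * K = e * c / 8 := by rw [hη]; field_simp
  have hsum : ∑ i ∈ (Finset.range n).filter (fun i => D i ω = false),
              (w n i ω) ^ 2 * (Y0 i ω - fhat0 n ω (X i ω)) ^ 2
      = ∑ i ∈ (Finset.range n).filter (fun i => D i ω = false),
          (w n i ω) ^ 2 * (ε i ω + (f0 (X i ω) - fhat0 n ω (X i ω))) ^ 2 := by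
    refine Finset.sum_congr rfl fun i hi => ?_
    have := (Finset.mem_filter.1 hi).2
    rw [hε, this]
    simp
  rw [hsum]
  have hr : (0 : ℝ) ≤ (nc n ω : ℝ)⁻¹ := by positivity
  have hy := tfb_young ((Finset.range n).filter (fun i => D i ω = false)) (fun i => w n i ω)
    (fun i => ε i ω) (fun i => f0 (X i ω) - fhat0 n ω (X i ω)) η _ hηpos hr
  generalize ∑ i ∈ (Finset.range n).filter (fun i => D i ω = false),
    (w n i ω) ^ 2 * (ε i ω + (f0 (X i ω) - fhat0 n ω (X i ω))) ^ 2 = R at *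
  generalize ∑ i ∈ (Finset.range n).filter (fun i => D i ω = false),
    (w n i ω) ^ 2 * (f0 (X i ω) - fhat0 n ω (X i ω)) ^ 2 = G at *
  generalize ∑ i ∈ (Finset.range n).filter (fun i => D i ω = false),
    (w n i ω) ^ 2 * (ε i ω) ^ 2 = E at *
  generalize ∑ i ∈ (Finset.range n).filter (fun i => D i ω = false),
    (w n i ω) ^ 2 * σsq i ω = S at *
  generalize (nc n ω : ℝ) = m at *
  have hq : c / 2 < m / n := by
    have := (abs_lt.1 h4).1; linarith
  have hq0 : 0 < m / n := by linarith [half_pos hc]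
  have hn : (n : ℝ) ≠ 0 := by rintro h; simp [h] at hq0
  have hm : m ≠ 0 := by rintro h; simp [h] at hq0
  have heq : (n : ℝ) * ((m ^ 2)⁻¹ * R - (m ^ 2)⁻¹ * S) - 0
      = (m / n)⁻¹ * (m⁻¹ * R - m⁻¹ * S) := by field_simp; ring
  rw [heq, abs_mul, abs_of_pos (inv_pos.2 hq0), inv_mul_lt_iff₀ hq0]
  rw [sub_zero] at h2 h3
  have k1 := abs_lt.1 h1
  have k2 := abs_lt.1 h2
  have k3 := abs_lt.1 h3
  have k4 := abs_le.1 hy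
  have hE : m⁻¹ * E ≤ K := by linarith [le_abs_self Vw]
  have t1 : η * (m⁻¹ * E) ≤ e * c / 8 := by
    rw [← d4]; exact mul_le_mul_of_nonneg_left hE hηpos.le
  have t2 : η⁻¹ * (m⁻¹ * G) ≤ η⁻¹ * δ :=
    mul_le_mul_of_nonneg_left k3.2.le (inv_pos.2 hηpos).le
  have t3 : c / 2 * e < m / n * e := mul_lt_mul_of_pos_right hq he
  have hec : 0 < e * c := by positivity
  rw [abs_lt]; constructor <;> linarith

end
end
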